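/- arXiv:1406.6030 — 2 statements merged into one kernel-verified Lean document; each statement's English description precedes it below -/
import Mathlib

section
/- Let X be a measurable space and let G : ℱ(X) → [0,1] be weakly averaging, affine, and limit-preserving, and let ν_G be the probability measure on X defined by ν_G(S) = G(χ_S) for measurable S ⊆ X. Then for every f ∈ ℱ(X), G(f) = ∫_X f dν_G. -/
open MeasureTheory Set Filter

/-- `f : Z → ℝ` represents an element of `ℱ(Z)`: a measurable function with values in `[0,1]`. -/
def IsUF {Z : Type*} [MeasurableSpace Z] (f : Z → ℝ) : Prop :=
  Measurable f ∧ ∀ z, f z ∈ Set.Icc (0 : ℝ) 1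

/-- A functional `G : ℱ(Z) → [0,1]` is weakly averaging if it sends each constant
function with value `c ∈ [0,1]` to `c`. -/
def WeaklyAveraging {Z : Type*} [MeasurableSpace Z] (G : (Z → ℝ) → ℝ) : Prop :=
  ∀ c ∈ Set.Icc (0 : ℝ) 1, G (fun _ => c) = c

/-- A functional `G : ℱ(Z) → [0,1]` is affine if it preserves convex combinations
(taken pointwise). -/
def IsAffineFunctional {Z : Type*} [MeasurableSpace Z] (G : (Z → ℝ) → ℝ) : Prop :=
  ∀ f g : Z → ℝ, IsUF f → IsUF g → ∀ α ∈ Set.Icc (0 : ℝ) 1,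
    G (fun z => α * f z + (1 - α) * g z) = α * G f + (1 - α) * G g

/-- A functional `G : ℱ(Z) → [0,1]` preserves limits if on each `f ∈ ℱ(Z)` its value is
the supremum of its values on simple (finite range) members of `ℱ(Z)` below `f`. -/
def PreservesLimitsFunctional {Z : Type*} [MeasurableSpace Z] (G : (Z → ℝ) → ℝ) : Prop :=
  ∀ f : Z → ℝ, IsUF f →
    G f = sSup {r : ℝ | ∃ ψ : Z → ℝ,
      IsUF ψ ∧ (Set.range ψ).Finite ∧ (∀ z, ψ z ≤ f z) ∧ G ψ = r}

theorem IsUF.integrable {X : Type*} [MeasurableSpace X] {μ : Measure X} [IsFiniteMeasure μ]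
    {f : X → ℝ} (hf : IsUF f) : Integrable f μ :=
  Integrable.of_mem_Icc 0 1 hf.1.aemeasurable (ae_of_all _ hf.2)

theorem IsUF.indicator {X : Type*} [MeasurableSpace X] {f : X → ℝ} (hf : IsUF f)
    {S : Set X} (hS : MeasurableSet S) : IsUF (S.indicator f) := by
  refine ⟨hf.1.indicator hS, fun z => ?_⟩
  by_cases hz : z ∈ S
  · simpa [hz] using hf.2 z
  · simp [hz]

theorem isUF_const {X : Type*} [MeasurableSpace X] {c : ℝ} (hc : c ∈ Set.Icc (0 : ℝ) 1) :
    IsUF (fun _ : X => c) :=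
  ⟨measurable_const, fun _ => hc⟩

theorem IsAffineFunctional.map_const_mul {X : Type*} [MeasurableSpace X] {G : (X → ℝ) → ℝ}
    (hAff : IsAffineFunctional G) (hWA : WeaklyAveraging G) {f : X → ℝ} (hf : IsUF f)
    {c : ℝ} (hc : c ∈ Set.Icc (0 : ℝ) 1) : G (fun z => c * f z) = c * G f := by
  have h0 : (0 : ℝ) ∈ Set.Icc (0 : ℝ) 1 := by simp
  simpa [hWA 0 h0] using hAff f (fun _ => 0) hf (isUF_const h0) c hc

theorem IsAffineFunctional.map_add {X : Type*} [MeasurableSpace X] {G : (X → ℝ) → ℝ}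
    (hAff : IsAffineFunctional G) (hWA : WeaklyAveraging G) {f g : X → ℝ} (hf : IsUF f)
    (hg : IsUF g) (hfg : IsUF (f + g)) : G (f + g) = G f + G g := by
  have hhalf : (1 / 2 : ℝ) ∈ Set.Icc (0 : ℝ) 1 := by norm_num
  have h₁ := hAff.map_const_mul hWA hfg hhalf
  have h₂ := hAff f g hf hg _ hhalf
  have h₃ : (fun z => 1 / 2 * (f + g) z) = fun z => 1 / 2 * f z + (1 - 1 / 2) * g z := by
    funext z
    simp only [Pi.add_apply]
    ring
  rw [h₃] at h₁
  linarith

/-- A weakly averaging affine functional agrees with the integral on simple functions. -/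
theorem IsAffineFunctional.eq_integral_of_finite_range {X : Type*} [MeasurableSpace X]
    {G : (X → ℝ) → ℝ} (hAff : IsAffineFunctional G) (hWA : WeaklyAveraging G)
    (hG01 : ∀ f, IsUF f → G f ∈ Set.Icc (0 : ℝ) 1)
    (μ : Measure X) [IsFiniteMeasure μ]
    (hμG : ∀ S : Set X, MeasurableSet S →
      μ S = ENNReal.ofReal (G (S.indicator fun _ => (1 : ℝ))))
    {ψ : X → ℝ} (hψ : IsUF ψ) (hfin : (Set.range ψ).Finite) : G ψ = ∫ x, ψ x ∂μ := by
  have h0 : (0 : ℝ) ∈ Set.Icc (0 : ℝ) 1 := by simp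
  have h1 : (1 : ℝ) ∈ Set.Icc (0 : ℝ) 1 := by simp
  have key : ∀ s : Finset ℝ, G ((ψ ⁻¹' s).indicator ψ) = ∫ x, (ψ ⁻¹' s).indicator ψ x ∂μ := by
    intro s
    induction s using Finset.induction_on with
    | empty =>
      have h : (ψ ⁻¹' (↑(∅ : Finset ℝ) : Set ℝ)).indicator ψ = fun _ => 0 := by simp
      rw [h, hWA 0 h0, integral_zero]
    | insert c s hcs ih =>
      have hmeas : ∀ t : Finset ℝ, MeasurableSet (ψ ⁻¹' t) := fun t => hψ.1 t.measurableSet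
      have hmc : MeasurableSet (ψ ⁻¹' {c}) := hψ.1 (measurableSet_singleton c)
      have hdisj : Disjoint (ψ ⁻¹' {c}) (ψ ⁻¹' s) :=
        Disjoint.preimage _ (by simpa using hcs)
      have hsplit : (ψ ⁻¹' (↑(insert c s) : Set ℝ)).indicator ψ =
          (ψ ⁻¹' {c}).indicator ψ + (ψ ⁻¹' s).indicator ψ := by
        rw [Finset.coe_insert, Set.insert_eq, Set.preimage_union,
          Set.indicator_union_of_disjoint hdisj]
        rfl
      have hpiece : G ((ψ ⁻¹' {c}).indicator ψ) = ∫ x, (ψ ⁻¹' {c}).indicator ψ x ∂μ := by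
        by_cases hc : c ∈ Set.Icc (0 : ℝ) 1
        · have hind : IsUF ((ψ ⁻¹' {c}).indicator fun _ => (1 : ℝ)) :=
            (isUF_const h1).indicator hmc
          have heq : (ψ ⁻¹' {c}).indicator ψ =
              fun z => c * (ψ ⁻¹' {c}).indicator (fun _ => (1 : ℝ)) z := by
            funext z
            by_cases hz : ψ z = c <;> simp [Set.indicator, hz]
          rw [heq, hAff.map_const_mul hWA hind hc, integral_const_mul,
            integral_indicator_const _ hmc, measureReal_def, hμG _ hmc,
            ENNReal.toReal_ofReal (hG01 _ hind).1, smul_eq_mul, mul_one]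
        · have hempty : ψ ⁻¹' {c} = ∅ :=
            Set.eq_empty_of_forall_notMem fun z hz => hc (hz ▸ hψ.2 z)
          have h : (ψ ⁻¹' {c}).indicator ψ = fun _ => 0 := by simp [hempty]
          rw [h, hWA 0 h0, integral_zero]
      have hsum := hψ.indicator (hmeas (insert c s))
      rw [hsplit] at hsum ⊢
      rw [hAff.map_add hWA (hψ.indicator hmc) (hψ.indicator (hmeas s)) hsum, ih, hpiece]
      exact (integral_add (hψ.indicator hmc).integrable
        (hψ.indicator (hmeas s)).integrable).symm
  have huniv : (ψ ⁻¹' (hfin.toFinset : Set ℝ)).indicator ψ = ψ := by simp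
  simpa only [huniv] using key hfin.toFinset

/-- Rounding down to multiples of `1 / n` approximates a function in `ℱ(X)` from below by simple
functions. -/
theorem IsUF.exists_simple_le {X : Type*} [MeasurableSpace X] {f : X → ℝ} (hf : IsUF f)
    {n : ℕ} (hn : 0 < n) :
    ∃ ψ : X → ℝ, IsUF ψ ∧ (Set.range ψ).Finite ∧ (∀ z, ψ z ≤ f z) ∧
      ∀ z, f z ≤ ψ z + 1 / n := by
  have hn' : (0 : ℝ) < n := by exact_mod_cast hn
  have hnonneg : ∀ z, 0 ≤ f z * n := fun z => mul_nonneg (hf.2 z).1 hn'.le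
  have hle : ∀ z, (⌊f z * n⌋₊ : ℝ) / n ≤ f z := fun z =>
    (div_le_iff₀ hn').2 (Nat.floor_le (hnonneg z))
  refine ⟨fun z => (⌊f z * n⌋₊ : ℝ) / n, ⟨?_, fun z => ⟨by positivity, ?_⟩⟩, ?_, hle, fun z => ?_⟩
  · have hfloor : Measurable fun z => ⌊f z * n⌋₊ := (hf.1.mul_const _).nat_floor
    exact (measurable_from_nat.comp hfloor).div_const _
  · exact (hle z).trans (hf.2 z).2
  · refine ((Finset.range (n + 1)).finite_toSet.image fun k : ℕ => (k : ℝ) / n).subset ?_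
    rintro _ ⟨z, rfl⟩
    refine ⟨⌊f z * n⌋₊, ?_, rfl⟩
    have : ⌊f z * n⌋₊ ≤ n :=
      Nat.floor_le_of_le (mul_le_of_le_one_left hn'.le (hf.2 z).2)
    simpa using Nat.lt_succ_of_le this
  · rw [← add_div, le_div_iff₀ hn']
    exact (Nat.lt_floor_add_one _).le

/-- if `G : ℱ(X) → [0,1]` is weakly averaging, affine and limit-preserving,
and `μ` is the probability measure with `μ(S) = G(χ_S)` for measurable `S`, then
`G(f) = ∫ f dμ` for every `f ∈ ℱ(X)`. -/
theorem weaklyAveraging_affine_limitPreserving_eq_integral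
    {X : Type*} [MeasurableSpace X] (G : (X → ℝ) → ℝ)
    (hG01 : ∀ f, IsUF f → G f ∈ Set.Icc (0 : ℝ) 1)
    (hWA : WeaklyAveraging G) (hAff : IsAffineFunctional G)
    (hPL : PreservesLimitsFunctional G)
    (μ : Measure X) (hμ : IsProbabilityMeasure μ)
    (hμG : ∀ S : Set X, MeasurableSet S →
      μ S = ENNReal.ofReal (G (S.indicator fun _ => (1 : ℝ)))) :
    ∀ f : X → ℝ, IsUF f → G f = ∫ x, f x ∂μ := by
  intro f hf
  have hsimple := fun {ψ : X → ℝ} => hAff.eq_integral_of_finite_range hWA hG01 μ hμG (ψ := ψ)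
  refine le_antisymm ?_ ?_
  · rw [hPL f hf]
    refine Real.sSup_le ?_ (integral_nonneg fun x => (hf.2 x).1)
    rintro _ ⟨ψ, hψ, hfin, hle, rfl⟩
    rw [hsimple hψ hfin]
    exact integral_mono hψ.integrable hf.integrable hle
  · refine le_of_forall_pos_le_add fun ε hε => ?_
    obtain ⟨n, hn⟩ := exists_nat_one_div_lt hε
    obtain ⟨ψ, hψ, hfin, hle, hge⟩ := hf.exists_simple_le n.succ_pos
    have hGle : G ψ ≤ G f := by
      rw [hPL f hf]
      refine le_csSup ⟨1, ?_⟩ ⟨ψ, hψ, hfin, hle, rfl⟩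
      rintro _ ⟨φ, hφ, -, -, rfl⟩
      exact (hG01 φ hφ).2
    calc ∫ x, f x ∂μ ≤ ∫ x, (ψ x + ε) ∂μ := by
          refine integral_mono hf.integrable (hψ.integrable.add (integrable_const ε)) fun x => ?_
          have := hge x
          push_cast at this
          dsimp only
          linarith
      _ = G ψ + ε := by
          rw [integral_add hψ.integrable (integrable_const ε), hsimple hψ hfin]
          simp
      _ ≤ G f + ε := by linarith
end

section
/- Let X be a measurable space, G : ℱ(X) → [0,1] weakly averaging, affine, and limit-preserving, f : X → Y a measurable function into a measurable space Y, and g ∈ ℱ(Y). Then sup { G(ψ ∘ f) : ψ ∈ ℱ(Y) simple, ψ ≤ g pointwise } = G(g ∘ f); that is, the pushforward functional g ↦ G(g ∘ f) preserves limits. -/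
open MeasureTheory Set Filter

theorem IsUF.comp {X Y : Type*} [MeasurableSpace X] [MeasurableSpace Y] {g : Y → ℝ} {f : X → Y}
    (hg : IsUF g) (hf : Measurable f) : IsUF (g ∘ f) :=
  ⟨hg.1.comp hf, fun x => hg.2 (f x)⟩

theorem IsUF.const {Z : Type*} [MeasurableSpace Z] {c : ℝ} (hc : c ∈ Set.Icc (0 : ℝ) 1) :
    IsUF (fun _ : Z => c) :=
  ⟨measurable_const, fun _ => hc⟩

theorem IsUF.convexComb {Z : Type*} [MeasurableSpace Z] {f g : Z → ℝ} (hf : IsUF f) (hg : IsUF g)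
    {α : ℝ} (hα : α ∈ Set.Icc (0 : ℝ) 1) : IsUF (fun z => α * f z + (1 - α) * g z) :=
  ⟨(hf.1.const_mul α).add (hg.1.const_mul (1 - α)), fun z =>
    convex_Icc (0 : ℝ) 1 (hf.2 z) (hg.2 z) hα.1 (sub_nonneg.2 hα.2) (add_sub_cancel α 1)⟩

/-- A limit-preserving functional is monotone. -/
theorem PreservesLimitsFunctional.mono {Z : Type*} [MeasurableSpace Z] {G : (Z → ℝ) → ℝ}
    (hG01 : ∀ f, IsUF f → G f ∈ Set.Icc (0 : ℝ) 1) (hPL : PreservesLimitsFunctional G)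
    {f g : Z → ℝ} (hf : IsUF f) (hg : IsUF g) (hfg : ∀ z, f z ≤ g z) : G f ≤ G g := by
  rw [hPL f hf, hPL g hg]
  refine csSup_le_csSup ⟨1, ?_⟩ ⟨_, fun _ => 0, IsUF.const (by simp), ?_, fun z => (hf.2 z).1, rfl⟩ ?_
  · rintro r ⟨ψ, hψ, -, -, rfl⟩
    exact (hG01 ψ hψ).2
  · exact (Set.finite_singleton (0 : ℝ)).subset Set.range_const_subset
  · rintro r ⟨ψ, hψ, hfin, hle, rfl⟩
    exact ⟨ψ, hψ, hfin, fun z => (hle z).trans (hfg z), rfl⟩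

/-- Uniform approximation from below by simple functions. -/
theorem IsUF.exists_simple_approx {Z : Type*} [MeasurableSpace Z] {g : Z → ℝ} (hg : IsUF g)
    {n : ℕ} (hn : 0 < n) : ∃ ψ : Z → ℝ, IsUF ψ ∧ (Set.range ψ).Finite ∧ (∀ z, ψ z ≤ g z) ∧
      ∀ z, g z ≤ ψ z + 1 / n := by
  have hn' : (0 : ℝ) < n := Nat.cast_pos.2 hn
  have hle : ∀ z, (⌊n * g z⌋₊ : ℝ) / n ≤ g z := fun z => by
    rw [div_le_iff₀' hn']
    exact Nat.floor_le (mul_nonneg hn'.le (hg.2 z).1)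
  refine ⟨fun z => (⌊n * g z⌋₊ : ℝ) / n, ⟨?_, fun z => ⟨by positivity, (hle z).trans (hg.2 z).2⟩⟩,
    ?_, hle, fun z => ?_⟩
  · have h : Measurable fun z => ⌊(n : ℝ) * g z⌋₊ := Nat.measurable_floor.comp (hg.1.const_mul _)
    exact (measurable_from_nat.comp h).div_const _
  · refine ((Set.finite_Iic n).image fun k : ℕ => (k : ℝ) / n).subset ?_
    rintro _ ⟨z, rfl⟩
    refine ⟨⌊n * g z⌋₊, Nat.floor_le_of_le ?_, rfl⟩
    exact mul_le_of_le_one_right hn'.le (hg.2 z).2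
  · rw [← add_div, le_div_iff₀' hn']
    exact (Nat.lt_floor_add_one _).le

/-- A monotone version of the Lipschitz estimate for affine, weakly averaging functionals. -/
theorem PreservesLimitsFunctional.le_add_of_le_add {Z : Type*} [MeasurableSpace Z]
    {G : (Z → ℝ) → ℝ} (hG01 : ∀ f, IsUF f → G f ∈ Set.Icc (0 : ℝ) 1) (hWA : WeaklyAveraging G)
    (hAff : IsAffineFunctional G) (hPL : PreservesLimitsFunctional G) {f g : Z → ℝ}
    (hf : IsUF f) (hg : IsUF g) {ε : ℝ} (hε : 0 ≤ ε) (hfg : ∀ z, f z ≤ g z + ε) :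
    G f ≤ G g + ε := by
  have hpos : 0 < 1 + ε := by linarith
  set α := (1 + ε)⁻¹ with hα_def
  have hα0 : 0 < α := inv_pos.2 hpos
  have hα : α ∈ Set.Icc (0 : ℝ) 1 := ⟨hα0.le, inv_le_one_of_one_le₀ (by linarith)⟩
  have hαε : 1 - α = α * ε := by
    have : α * (1 + ε) = 1 := inv_mul_cancel₀ hpos.ne'
    linarith
  have h0 : (0 : ℝ) ∈ Set.Icc (0 : ℝ) 1 := by simp
  have h1 : (1 : ℝ) ∈ Set.Icc (0 : ℝ) 1 := by simp
  have key := hPL.mono hG01 (hf.convexComb (IsUF.const h0) hα) (hg.convexComb (IsUF.const h1) hα)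
    fun z => by
      rw [hαε]
      nlinarith [mul_le_mul_of_nonneg_left (hfg z) hα0.le]
  rw [hAff f _ hf (IsUF.const h0) α hα, hAff g _ hg (IsUF.const h1) α hα, hWA 0 h0, hWA 1 h1,
    hαε] at key
  refine le_of_mul_le_mul_left ?_ hα0
  linarith

/-- for `G : ℱ(X) → [0,1]` weakly averaging, affine and limit-preserving,
`f : X → Y` measurable and `g ∈ ℱ(Y)`,
`sup { G(ψ ∘ f) : ψ ∈ ℱ(Y) simple, ψ ≤ g } = G(g ∘ f)`;
that is, the pushforward functional `g ↦ G(g ∘ f)` preserves limits. -/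
theorem pushforward_functional_preserves_limits
    {X Y : Type*} [MeasurableSpace X] [MeasurableSpace Y]
    (G : (X → ℝ) → ℝ)
    (hG01 : ∀ f, IsUF f → G f ∈ Set.Icc (0 : ℝ) 1)
    (hWA : WeaklyAveraging G) (hAff : IsAffineFunctional G)
    (hPL : PreservesLimitsFunctional G)
    (f : X → Y) (hf : Measurable f)
    (g : Y → ℝ) (hg : IsUF g) :
    sSup {r : ℝ | ∃ ψ : Y → ℝ,
        IsUF ψ ∧ (Set.range ψ).Finite ∧ (∀ y, ψ y ≤ g y) ∧ G (ψ ∘ f) = r}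
      = G (g ∘ f) := by
  have hmono : ∀ ψ : Y → ℝ, IsUF ψ → (∀ y, ψ y ≤ g y) → G (ψ ∘ f) ≤ G (g ∘ f) :=
    fun ψ hψ hle => hPL.mono hG01 (hψ.comp hf) (hg.comp hf) fun x => hle (f x)
  apply csSup_eq_of_forall_le_of_forall_lt_exists_gt
  · exact ⟨_, fun _ => 0, IsUF.const (by simp),
      (Set.finite_singleton (0 : ℝ)).subset Set.range_const_subset, fun y => (hg.2 y).1, rfl⟩
  · rintro r ⟨ψ, hψ, -, hle, rfl⟩
    exact hmono ψ hψ hle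
  · intro w hw
    obtain ⟨n, hn⟩ := exists_nat_one_div_lt (sub_pos.2 hw)
    obtain ⟨ψ, hψ, hfin, hle, happ⟩ := hg.exists_simple_approx n.succ_pos
    refine ⟨_, ⟨ψ, hψ, hfin, hle, rfl⟩, ?_⟩
    have := hPL.le_add_of_le_add hG01 hWA hAff (hg.comp hf) (hψ.comp hf) (by positivity)
      fun x => happ (f x)
    push_cast at this
    linarith
end
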